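/- arXiv:1904.11019 — 2 statements merged into one kernel-verified Lean document; each statement's English description precedes it below -/
import Mathlib

section
/- Fix k > 0 with k/π not an integer. Define a₀₀ = 1, a_{m0} = a_{0n} = 2 for m, n ≥ 1, a_{mn} = 4 for m, n ≥ 1, and for ε > 0 let c_{mn}(ε) = (k² − (mπ/ε)² − (nπ)²)⁻¹. Then: (i) for every ε ∈ (0, π/k) and every m ≥ 0 the series s_m(ε) = Σ_{n=0}^∞ a_{mn} c_{mn}(ε) converges absolutely; and (ii) there exist ε₀ > 0 and C > 0 such that for every ε ∈ (0, ε₀) and all X, Y ∈ (−1/2, 1/2) with X ≠ Y, the partial sums ε⁻¹·Σ_{m=0}^{M} s_m(ε)·cos(mπ(X + 1/2))·cos(mπ(Y + 1/2)) converge as M → ∞ to a limit G_ε^i(X, Y) ∈ ℝ satisfying |G_ε^i(X, Y) − 1/(ε·k·tan k) − (2 log 2)/π − (1/π)·(log|sin(π(X − Y)/2)| + log|sin(π(X + Y + 1)/2)|)| ≤ C·ε². -/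
open Real Filter Topology

/-- The coefficients `a₀₀ = 1`, `a_{m0} = a_{0n} = 2` (for `m,n ≥ 1`), `a_{mn} = 4`. -/
noncomputable def aCoef (m n : ℕ) : ℝ :=
  if m = 0 ∧ n = 0 then 1 else if m = 0 ∨ n = 0 then 2 else 4

/-- `c_{mn}(ε) = (k² − (mπ/ε)² − (nπ)²)⁻¹`. -/
noncomputable def cCoef (k ε : ℝ) (m n : ℕ) : ℝ :=
  (k ^ 2 - (m * π / ε) ^ 2 - (n * π) ^ 2)⁻¹

/-- Mittag-Leffler expansion of `cot z / z` off `πℤ`. -/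
lemma tsum_two_mul_inv_sq_sub_sq (z : ℂ) (hz : z / π ∈ Complex.integerComplement) :
    (z ^ 2)⁻¹ + ∑' n : ℕ, 2 * (z ^ 2 - (((n + 1 : ℕ) : ℂ) * π) ^ 2)⁻¹ = Complex.cot z / z := by
  have hπ : (π : ℂ) ≠ 0 := by exact_mod_cast pi_ne_zero
  have hz0 : z ≠ 0 := fun h => Complex.integerComplement.ne_zero hz (by simp [h])
  have hseries := cot_series_rep' hz
  have hterm : ∀ n : ℕ, 1 / (z / π - (n + 1)) + 1 / (z / π + (n + 1)) =
      (π * z) * (2 * (z ^ 2 - (((n + 1 : ℕ) : ℂ) * π) ^ 2)⁻¹) := by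
    intro n
    have hadd : z / π + (n + 1) ≠ 0 := by
      simpa using Complex.integerComplement_add_ne_zero hz (n + 1)
    have hsub : z / π - (n + 1) ≠ 0 := by
      simpa [sub_eq_add_neg, add_comm] using
        Complex.integerComplement_add_ne_zero hz (-(n + 1))
    have hadd' : z + (n + 1) * π ≠ 0 := by
      intro h; apply hadd; field_simp; linear_combination h
    have hsub' : z - (n + 1) * π ≠ 0 := by
      intro h; apply hsub; field_simp; linear_combination h
    have hmul : z ^ 2 - (((n + 1 : ℕ) : ℂ) * π) ^ 2 =
        (z - (n + 1) * π) * (z + (n + 1) * π) := by push_cast; ring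
    have h1 : z / π - (n + 1) = (z - (n + 1) * π) / π := by field_simp
    have h2 : z / π + (n + 1) = (z + (n + 1) * π) / π := by field_simp
    rw [hmul, h1, h2]
    field_simp
    ring
  simp_rw [hterm] at hseries
  rw [tsum_mul_left, mul_div_cancel₀ _ hπ] at hseries
  field_simp at hseries ⊢
  linear_combination -hseries

lemma summable_abs_inv_sub_sq (c : ℝ) :
    Summable (fun n : ℕ => |(c - (n * π) ^ 2)⁻¹|) := by
  refine Summable.of_norm_bounded_eventually_nat
    (Real.summable_one_div_nat_pow.2 (one_lt_two : 1 < 2)) ?_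
  filter_upwards [eventually_ge_atTop (⌈|c|⌉₊ + 1)] with n hn
  have hn' : |c| + 1 ≤ n := (add_le_add_left (Nat.le_ceil _) _).trans (by exact_mod_cast hn)
  have hc := le_abs_self c
  have hc0 := abs_nonneg c
  have hπ : 9 ≤ π ^ 2 := by nlinarith [pi_gt_three]
  have hn2 : (n : ℝ) ≤ n ^ 2 := by nlinarith
  have hle : (n : ℝ) ^ 2 ≤ (n * π) ^ 2 - c := by
    rw [mul_pow]; nlinarith
  rw [norm_abs_eq_norm, norm_inv, Real.norm_eq_abs, abs_sub_comm, ← one_div,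
    abs_of_nonneg (by nlinarith)]
  exact one_div_le_one_div_of_le (by nlinarith) hle

lemma tsum_eq_inv_mul_tan {k : ℝ} (hkπ : ∀ m : ℤ, k ≠ m * π) :
    (k ^ 2)⁻¹ + ∑' n : ℕ, 2 * (k ^ 2 - (((n + 1 : ℕ) : ℝ) * π) ^ 2)⁻¹ = 1 / (k * tan k) := by
  have hz : (k : ℂ) / π ∈ Complex.integerComplement := by
    rintro ⟨m, hm⟩
    apply hkπ m
    have : (m : ℝ) = k / π := by exact_mod_cast hm
    rw [this, div_mul_cancel₀ _ pi_ne_zero]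
  have h := tsum_two_mul_inv_sq_sub_sq k hz
  rw [← Complex.ofReal_inj]
  push_cast at h ⊢
  rw [h, Complex.cot_eq_cos_div_sin, Complex.tan_eq_sin_div_cos, one_div, mul_inv, inv_div,
    div_eq_mul_inv _ (k : ℂ), mul_comm]

lemma tsum_eq_coth_div {μ : ℝ} (hμ : 0 < μ) :
    (μ ^ 2)⁻¹ + ∑' n : ℕ, 2 * (μ ^ 2 + (((n + 1 : ℕ) : ℝ) * π) ^ 2)⁻¹ =
      cosh μ / sinh μ / μ := by
  have hz : (μ * Complex.I) / π ∈ Complex.integerComplement := by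
    rintro ⟨m, hm⟩
    have him := congrArg Complex.im hm
    rw [mul_div_right_comm, ← Complex.ofReal_div] at him
    simp only [Complex.intCast_im, Complex.im_ofReal_mul, Complex.I_im, mul_one] at him
    exact (div_pos hμ pi_pos).ne him
  have h := tsum_two_mul_inv_sq_sub_sq (μ * Complex.I) hz
  have hterm : ∀ n : ℕ, 2 * ((μ * Complex.I) ^ 2 - (((n + 1 : ℕ) : ℂ) * π) ^ 2)⁻¹ =
      -(2 * ((μ : ℂ) ^ 2 + (((n + 1 : ℕ) : ℂ) * π) ^ 2)⁻¹) := by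
    intro n
    rw [← mul_neg, ← inv_neg]
    congr 2
    rw [mul_pow, Complex.I_sq]; ring
  simp_rw [hterm] at h
  rw [tsum_neg, Complex.cot_eq_cos_div_sin, Complex.cos_mul_I, Complex.sin_mul_I, mul_pow,
    Complex.I_sq] at h
  rw [← Complex.ofReal_inj]
  push_cast at h ⊢
  have hR : Complex.cosh μ / (Complex.sinh μ * Complex.I) / (μ * Complex.I) =
      -(Complex.cosh μ / Complex.sinh μ / μ) := by
    rw [div_div, div_div, mul_mul_mul_comm, Complex.I_mul_I, mul_neg_one, div_neg]
  rw [hR, mul_neg_one, inv_neg] at h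
  linear_combination -h

lemma coth_sub_one_bounds {μ : ℝ} (hμ : 0 < μ) :
    0 ≤ cosh μ / sinh μ - 1 ∧ cosh μ / sinh μ - 1 ≤ 1 / μ ^ 2 := by
  have hs : 0 < sinh μ := sinh_pos_iff.2 hμ
  have heq : cosh μ / sinh μ - 1 = exp (-μ) / sinh μ := by
    rw [← cosh_sub_sinh]; field_simp
  rw [heq]
  refine ⟨by positivity, ?_⟩
  rw [div_le_div_iff₀ hs (by positivity), one_mul, sinh_eq]
  have hq := quadratic_le_exp_of_nonneg (x := 2 * μ) (by positivity)
  have hexp : exp μ = exp (-μ) * exp (2 * μ) := by rw [← exp_add]; ring_nf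
  rw [hexp]
  nlinarith [exp_pos (-μ)]

/-- The Fourier series of `-log |2 sin (θ / 2)|`. -/
lemma tendsto_sum_cos_div {θ : ℝ} (hθ : sin (θ / 2) ≠ 0) :
    Tendsto (fun M : ℕ => ∑ i ∈ Finset.range M, cos ((i + 1 : ℕ) * θ) / (i + 1 : ℕ))
      atTop (𝓝 (-(log 2 + log |sin (θ / 2)|))) := by
  set w : ℂ := Complex.exp (Complex.I * θ) with hw
  have hw_norm : ‖w‖ = 1 := by rw [hw, mul_comm]; exact Complex.norm_exp_ofReal_mul_I θ
  have hdist : ‖w - 1‖ = 2 * |sin (θ / 2)| := by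
    rw [hw, Complex.norm_exp_I_mul_ofReal_sub_one]; simp
  have hw1 : w ≠ 1 := by
    intro h
    rw [h, sub_self, norm_zero] at hdist
    exact hθ (abs_eq_zero.1 (by linarith))
  have hwpos : 0 < ‖w - 1‖ := norm_pos_iff.2 (sub_ne_zero.2 hw1)
  have hcauchy : CauchySeq fun n ↦ ∑ i ∈ Finset.range n, (1 / ((i : ℝ) + 1)) • w ^ (i + 1) := by
    refine Antitone.cauchySeq_series_mul_of_tendsto_zero_of_bounded (b := 2 / ‖w - 1‖)
      (fun a b hab => ?_) tendsto_one_div_add_atTop_nhds_zero_nat (fun n => ?_)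
    · have : (a : ℝ) ≤ b := by exact_mod_cast hab
      exact one_div_le_one_div_of_le (by positivity) (by linarith)
    · simp_rw [pow_succ]
      rw [← Finset.sum_mul, geom_sum_eq hw1, norm_mul, hw_norm, mul_one, norm_div]
      gcongr
      calc ‖w ^ n - 1‖ ≤ ‖w ^ n‖ + ‖(1 : ℂ)‖ := norm_sub_le _ _
        _ = 2 := by rw [norm_pow, hw_norm]; norm_num
  obtain ⟨l, hl⟩ := cauchySeq_tendsto_of_complete hcauchy
  have habel := Complex.tendsto_tsum_powerSeries_nhdsWithin_lt hl
  rw [tendsto_map'_iff] at habel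
  have hre : Tendsto (fun r : ℝ => -log ‖1 - r * w‖) (𝓝[<] 1) (𝓝 l.re) := by
    have hr1 : Tendsto (fun r : ℝ => (r : ℂ)) (𝓝[<] 1) (𝓝 1) := by
      have : Tendsto (fun r : ℝ => (r : ℂ)) (𝓝 1) (𝓝 ((1 : ℝ) : ℂ)) :=
        Complex.continuous_ofReal.tendsto 1
      simpa using this.mono_left nhdsWithin_le_nhds
    have hlim := (Complex.continuous_re.tendsto _).comp (hr1.mul habel)
    rw [one_mul] at hlim
    refine hlim.congr' ?_
    filter_upwards [Ioo_mem_nhdsLT (zero_lt_one' ℝ)] with r hr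
    have hnorm : ‖(r : ℂ) * w‖ < 1 := by
      rw [norm_mul, hw_norm, mul_one, Complex.norm_real, Real.norm_eq_abs, abs_of_pos hr.1]
      exact hr.2
    have hsum := (Complex.hasSum_taylorSeries_neg_log' hnorm).tsum_eq
    have hmul : (r : ℂ) * ∑' n : ℕ, (1 / ((n : ℝ) + 1)) • w ^ (n + 1) * (r : ℂ) ^ n =
        -Complex.log (1 - r * w) := by
      rw [← hsum, ← tsum_mul_left]
      refine tsum_congr fun n => ?_
      rw [Complex.real_smul]
      push_cast
      ring
    simp only [Function.comp_apply]
    rw [hmul, Complex.neg_re, Complex.log_re]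
  have hcont : Tendsto (fun r : ℝ => -log ‖1 - r * w‖) (𝓝[<] 1) (𝓝 (-log ‖1 - w‖)) := by
    have hne : ‖1 - ((1 : ℝ) : ℂ) * w‖ ≠ 0 := by
      rw [Complex.ofReal_one, one_mul, norm_sub_rev]; exact hwpos.ne'
    have hc : ContinuousAt (fun r : ℝ => -log ‖1 - r * w‖) 1 :=
      (ContinuousAt.log (f := fun r : ℝ => ‖1 - r * w‖) (by fun_prop) hne).neg
    simpa using hc.tendsto.mono_left nhdsWithin_le_nhds
  have hval : l.re = -(log 2 + log |sin (θ / 2)|) := by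
    rw [tendsto_nhds_unique hre hcont, norm_sub_rev, hdist,
      log_mul two_ne_zero (abs_ne_zero.2 hθ)]
  rw [← hval]
  refine ((Complex.continuous_re.tendsto _).comp hl).congr fun M => ?_
  simp only [Function.comp_apply, Complex.re_sum]
  refine Finset.sum_congr rfl fun i _ => ?_
  have hpow : w ^ (i + 1) = Complex.exp (((i + 1 : ℕ) * θ : ℝ) * Complex.I) := by
    rw [hw, ← Complex.exp_nat_mul]; push_cast; ring_nf
  rw [hpow, Complex.real_smul, Complex.re_ofReal_mul, Complex.exp_ofReal_mul_I_re]
  push_cast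
  ring

lemma summable_abs_aCoef_mul_cCoef (k ε : ℝ) (m : ℕ) :
    Summable (fun n : ℕ => |aCoef m n * cCoef k ε m n|) := by
  refine Summable.of_nonneg_of_le (fun _ => abs_nonneg _) (fun n => ?_)
    ((summable_abs_inv_sub_sq (k ^ 2 - (m * π / ε) ^ 2)).mul_left 4)
  rw [abs_mul]
  refine mul_le_mul_of_nonneg_right ?_ (abs_nonneg _)
  unfold aCoef
  split_ifs <;> norm_num

lemma tsum_aCoef_zero {k : ℝ} (hkπ : ∀ m : ℤ, k ≠ m * π) (ε : ℝ) :
    ∑' n : ℕ, aCoef 0 n * cCoef k ε 0 n = 1 / (k * tan k) := by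
  rw [(summable_abs_aCoef_mul_cCoef k ε 0).of_abs.tsum_eq_zero_add, ← tsum_eq_inv_mul_tan hkπ]
  simp [aCoef, cCoef]

lemma tsum_aCoef_pos {k ε μ : ℝ} {m : ℕ} (hm : m ≠ 0) (hμ : 0 < μ)
    (hμ2 : μ ^ 2 = (m * π / ε) ^ 2 - k ^ 2) :
    ∑' n : ℕ, aCoef m n * cCoef k ε m n = -2 * (cosh μ / sinh μ / μ) := by
  rw [(summable_abs_aCoef_mul_cCoef k ε m).of_abs.tsum_eq_zero_add, ← tsum_eq_coth_div hμ,
    mul_add, ← tsum_mul_left]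
  have hc : ∀ n : ℕ, cCoef k ε m n = -(μ ^ 2 + (n * π) ^ 2)⁻¹ := by
    intro n
    rw [cCoef, ← inv_neg, hμ2]
    congr 1; ring
  simp_rw [hc]
  congr 1
  · simp [aCoef, hm]
  · refine tsum_congr fun n => ?_
    simp only [aCoef, hm, Nat.succ_ne_zero, and_self, or_self, if_false]
    ring

/-- The coefficient of the `m`-th transverse mode is `-2 / (m π)` up to `O(ε² / m²)`. -/
lemma abs_mode_coeff_le {k ε : ℝ} (hk : 0 < k) (hε : 0 < ε) (hkε : ε * k ≤ 1) {m : ℕ}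
    (hm : m ≠ 0) :
    |ε⁻¹ * (∑' n : ℕ, aCoef m n * cCoef k ε m n) + 2 / (m * π)| ≤
      2 * (1 + k ^ 2) * ε ^ 2 * (1 / (m : ℝ) ^ 2) := by
  have hm1 : (1 : ℝ) ≤ m := by exact_mod_cast Nat.one_le_iff_ne_zero.2 hm
  have hπ : 3 < π := pi_gt_three
  set ν : ℝ := √((m * π) ^ 2 - (ε * k) ^ 2) with hν
  have hkε2 : (ε * k) ^ 2 ≤ 1 := by
    have : 0 < ε * k := by positivity
    nlinarith
  have hmπ : (m : ℝ) ≤ m * π := by nlinarith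
  have hlow : (m : ℝ) ^ 2 ≤ (m * π) ^ 2 - (ε * k) ^ 2 := by
    have : 9 ≤ π ^ 2 := by nlinarith
    rw [mul_pow (m : ℝ)]; nlinarith
  have hν2 : ν ^ 2 = (m * π) ^ 2 - (ε * k) ^ 2 := sq_sqrt ((sq_nonneg _).trans hlow)
  have hmν : (m : ℝ) ≤ ν := le_sqrt_of_sq_le hlow
  have hν1 : 1 ≤ ν := hm1.trans hmν
  have hνle : ν ≤ m * π := by
    refine sqrt_le_iff.2 ⟨by positivity, ?_⟩
    linarith [sq_nonneg (ε * k)]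
  have hμ : 0 < ν / ε := by positivity
  have hμ2 : (ν / ε) ^ 2 = (m * π / ε) ^ 2 - k ^ 2 := by
    rw [div_pow, hν2]; field_simp
  rw [tsum_aCoef_pos hm hμ hμ2]
  obtain ⟨hc0, hc1⟩ := coth_sub_one_bounds hμ
  set c : ℝ := cosh (ν / ε) / sinh (ν / ε) - 1 with hc
  have hsplit : ε⁻¹ * (-2 * (cosh (ν / ε) / sinh (ν / ε) / (ν / ε))) + 2 / (m * π) =
      -(2 * (c / ν + (1 / ν - 1 / (m * π)))) := by
    have : cosh (ν / ε) / sinh (ν / ε) = c + 1 := by rw [hc]; ring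
    rw [this]
    field_simp
    ring
  have hfirst : c / ν ≤ ε ^ 2 * (1 / (m : ℝ) ^ 2) := by
    calc c / ν ≤ c := div_le_self hc0 hν1
      _ ≤ 1 / (ν / ε) ^ 2 := hc1
      _ = ε ^ 2 * (1 / ν ^ 2) := by field_simp
      _ ≤ _ := by gcongr
  have hsecond : 1 / ν - 1 / (m * π) ≤ k ^ 2 * ε ^ 2 * (1 / (m : ℝ) ^ 2) := by
    have heq : 1 / ν - 1 / (m * π) = k ^ 2 * ε ^ 2 * (1 / (ν * (m * π) * (m * π + ν))) := by
      field_simp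
      linear_combination -hν2
    rw [heq]
    gcongr
    nlinarith [mul_le_mul hmν hmπ (by positivity) (by positivity)]
  have hsecond0 : 0 ≤ 1 / ν - 1 / (m * π) :=
    sub_nonneg.2 (one_div_le_one_div_of_le (by positivity) hνle)
  have hfirst0 : 0 ≤ c / ν := by positivity
  rw [hsplit, abs_neg, abs_of_nonneg (by positivity)]
  linarith

/-- Fix `k > 0` with `k/π` not an integer. (i) For `ε ∈ (0, π/k)`
and every `m`, the series `s_m(ε) = Σ_n a_{mn} c_{mn}(ε)` converges absolutely.
(ii) There are `ε₀, C > 0` such that for `ε ∈ (0,ε₀)` and `X ≠ Y` in `(-1/2,1/2)`,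
the partial sums `ε⁻¹ Σ_{m=0}^M s_m(ε) cos(mπ(X+1/2)) cos(mπ(Y+1/2))` converge to a
real limit `G_ε^i(X,Y)` with
`|G_ε^i(X,Y) − 1/(εk tan k) − 2log2/π − (1/π)(log|sin(π(X−Y)/2)| + log|sin(π(X+Y+1)/2)|)| ≤ Cε²`. -/
theorem stmt_13 (k : ℝ) (hk : 0 < k) (hkπ : ∀ m : ℤ, k ≠ m * π) :
    (∀ ε : ℝ, 0 < ε → ε < π / k → ∀ m : ℕ,
      Summable (fun n : ℕ => |aCoef m n * cCoef k ε m n|)) ∧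
    ∃ ε₀ > 0, ∃ C > 0, ∀ ε : ℝ, 0 < ε → ε < ε₀ →
      ∀ X Y : ℝ, X ∈ Set.Ioo (-(1 : ℝ) / 2) (1 / 2) → Y ∈ Set.Ioo (-(1 : ℝ) / 2) (1 / 2) →
        X ≠ Y →
        ∃ G : ℝ,
          Tendsto (fun M : ℕ =>
              ε⁻¹ * ∑ m ∈ Finset.range (M + 1),
                (∑' n : ℕ, aCoef m n * cCoef k ε m n) *
                  Real.cos (m * π * (X + 1 / 2)) * Real.cos (m * π * (Y + 1 / 2)))
            atTop (nhds G) ∧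
          |G - 1 / (ε * k * Real.tan k) - 2 * Real.log 2 / π -
              (1 / π) * (Real.log |Real.sin (π * (X - Y) / 2)| +
                Real.log |Real.sin (π * (X + Y + 1) / 2)|)|
            ≤ C * ε ^ 2 := by
  refine ⟨fun ε _ _ m => summable_abs_aCoef_mul_cCoef k ε m, 1 / k, by positivity, ?_⟩
  have hsum : Summable fun i : ℕ => 1 / (((i + 1 : ℕ) : ℝ)) ^ 2 :=
    (summable_nat_add_iff 1).2 (Real.summable_one_div_nat_pow.2 one_lt_two)
  have hS : 0 < ∑' i : ℕ, 1 / (((i + 1 : ℕ) : ℝ)) ^ 2 :=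
    hsum.tsum_pos (fun i => by positivity) 0 (by norm_num)
  refine ⟨2 * (1 + k ^ 2) * ∑' i : ℕ, 1 / (((i + 1 : ℕ) : ℝ)) ^ 2, by positivity, ?_⟩
  intro ε hε hεk X Y hX hY hXY
  have hkε : ε * k ≤ 1 := ((lt_div_iff₀ hk).1 hεk).le
  have hsub : sin (π * (X - Y) / 2) ≠ 0 := by
    intro h
    have hlo : -π < π * (X - Y) / 2 := by nlinarith [pi_pos, hX.1, hX.2, hY.1, hY.2]
    have hhi : π * (X - Y) / 2 < π := by nlinarith [pi_pos, hX.1, hX.2, hY.1, hY.2]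
    have h0 := (sin_eq_zero_iff_of_lt_of_lt hlo hhi).1 h
    rw [div_eq_zero_iff, mul_eq_zero, sub_eq_zero] at h0
    simp [pi_ne_zero, hXY] at h0
  have hadd : sin (π * (X + Y + 1) / 2) ≠ 0 :=
    (sin_pos_of_pos_of_lt_pi (by nlinarith [pi_pos, hX.1, hY.1])
      (by nlinarith [pi_pos, hX.2, hY.2])).ne'
  set r : ℕ → ℝ := fun i =>
    (ε⁻¹ * (∑' n : ℕ, aCoef (i + 1) n * cCoef k ε (i + 1) n) + 2 / ((i + 1 : ℕ) * π)) *
      (cos ((i + 1 : ℕ) * π * (X + 1 / 2)) * cos ((i + 1 : ℕ) * π * (Y + 1 / 2))) with hr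
  have hrle : ∀ i, ‖r i‖ ≤ 2 * (1 + k ^ 2) * ε ^ 2 * (1 / (((i + 1 : ℕ) : ℝ)) ^ 2) := by
    intro i
    rw [hr, norm_mul, norm_mul]
    refine (mul_le_of_le_one_right (norm_nonneg _) ?_).trans
      (abs_mode_coeff_le hk hε hkε i.succ_ne_zero)
    exact mul_le_one₀ (abs_cos_le_one _) (norm_nonneg _) (abs_cos_le_one _)
  have hbound := hsum.mul_left (2 * (1 + k ^ 2) * ε ^ 2)
  have hrsum : Summable r := Summable.of_norm_bounded hbound hrle
  have hrtsum := tsum_of_norm_bounded hbound.hasSum hrle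
  rw [tsum_mul_left] at hrtsum
  have hlim := (((tendsto_sum_cos_div hsub).add (tendsto_sum_cos_div hadd)).const_mul
    (-1 / π)).add hrsum.hasSum.tendsto_sum_nat |>.const_add (1 / (ε * k * tan k))
  refine ⟨_, hlim.congr fun M => ?_, ?_⟩
  · rw [Finset.sum_range_succ', tsum_aCoef_zero hkπ, ← Finset.sum_add_distrib, Finset.mul_sum,
      ← Finset.sum_add_distrib, add_comm, mul_add ε⁻¹, Finset.mul_sum]
    congr 1
    · refine Finset.sum_congr rfl fun i _ => ?_
      have hcos : cos ((i + 1 : ℕ) * (π * (X - Y))) + cos ((i + 1 : ℕ) * (π * (X + Y + 1))) =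
          2 * (cos ((i + 1 : ℕ) * π * (X + 1 / 2)) * cos ((i + 1 : ℕ) * π * (Y + 1 / 2))) := by
        rw [← mul_assoc 2, two_mul_cos_mul_cos]
        ring_nf
      rw [← add_div, hcos, hr]
      field_simp
      ring
    · simp only [Nat.cast_zero, zero_mul, cos_zero, mul_one]
      rw [← one_div, one_div_mul_one_div, mul_assoc]
  · refine le_trans (le_of_eq ?_) (hrtsum.trans (le_of_eq ?_))
    · rw [Real.norm_eq_abs]
      congr 1
      ring
    · ring
end

section
/- Fix k > 0 with k/π not an integer. Define a₀₀ = 1, a_{m0} = a_{0n} = 2 for m, n ≥ 1, a_{mn} = 4 for m, n ≥ 1, and for ε > 0 let c_{mn}(ε) = (k² − (mπ/ε)² − (nπ)²)⁻¹. For every ε ∈ (0, π/k) and m ≥ 0 the series t_m(ε) = Σ_{n=0}^∞ (−1)ⁿ a_{mn} c_{mn}(ε) converges absolutely. There exist ε₀ > 0 and C > 0 such that for every ε ∈ (0, ε₀) and all X, Y ∈ [−1/2, 1/2], the series G̃_ε(X, Y) = ε⁻¹·Σ_{m=0}^∞ t_m(ε)·cos(mπ(X + 1/2))·cos(mπ(Y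 + 1/2)) converges absolutely and satisfies |G̃_ε(X, Y) − 1/(ε·k·sin k)| ≤ C·e^{−1/ε}. -/
open Real Filter Topology

open Complex in
/-- The Mittag-Leffler expansion of the cosecant. -/
theorem hasSum_neg_one_pow_mul_cotTerm {z : ℂ} (hz : z ∈ integerComplement) :
    HasSum (fun n : ℕ => (-1 : ℂ) ^ (n + 1) * cotTerm z n) (π / sin (π * z) - 1 / z) := by
  have hz₂ : z / 2 ∈ integerComplement := by
    rintro ⟨n, hn⟩
    exact hz ⟨2 * n, by push_cast; rw [hn]; ring⟩
  have hcot {x : ℂ} (hx : x ∈ integerComplement) :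
      HasSum (cotTerm x) (π * cot (π * x) - 1 / x) := by
    rw [cot_series_rep' hx]
    exact (summable_cotTerm hx).hasSum
  have hodd (j : ℕ) : cotTerm (z / 2) j =
      (-1 : ℂ) ^ (2 * j + 1 + 1) * cotTerm z (2 * j + 1) + cotTerm z (2 * j + 1) := by
    rw [cotTerm_identity hz₂, cotTerm_identity hz,
      Even.neg_one_pow ⟨j + 1, by ring⟩]
    have h1 : z + (2 * j + 1 + 1) ≠ 0 := by
      simpa using integerComplement_add_ne_zero hz (2 * j + 1 + 1 : ℤ)
    have h2 : z - (2 * j + 1 + 1) ≠ 0 := by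
      simpa [sub_eq_add_neg] using integerComplement_add_ne_zero hz (-(2 * j + 1 + 1) : ℤ)
    rw [show z / 2 + (j + 1) = (z + (2 * j + 1 + 1)) / 2 by ring,
      show z / 2 - (j + 1) = (z - (2 * j + 1 + 1)) / 2 by ring]
    push_cast
    field_simp
    ring
  have heven (j : ℕ) :
      (-1 : ℂ) ^ (2 * j + 1) * cotTerm z (2 * j) + cotTerm z (2 * j) = 0 := by
    rw [Odd.neg_one_pow ⟨j, rfl⟩]
    ring
  have hsum : HasSum (fun n : ℕ => (-1 : ℂ) ^ (n + 1) * cotTerm z n + cotTerm z n)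
      (0 + (π * cot (π * (z / 2)) - 1 / (z / 2))) := by
    refine HasSum.even_add_odd ?_ ?_
    · simpa only [heven] using hasSum_zero
    · simpa only [← hodd] using hcot hz₂
  have hsin : sin (π * z) ≠ 0 := by
    intro h
    obtain ⟨n, hn⟩ := sin_eq_zero_iff.mp h
    have hpi : (π : ℂ) ≠ 0 := by exact_mod_cast Real.pi_ne_zero
    exact hz ⟨n, mul_left_cancel₀ hpi (by rw [hn]; ring)⟩
  convert hsum.sub (hcot hz) using 1
  · rfl
  · ext n
    ring
  · have hz0 := integerComplement.ne_zero hz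
    obtain ⟨u, hu⟩ : ∃ u : ℂ, u = π * (z / 2) := ⟨_, rfl⟩
    have hzu : (π : ℂ) * z = 2 * u := by rw [hu]; ring
    rw [hzu, Complex.sin_two_mul] at hsin
    have hs : sin u ≠ 0 := fun h => hsin (by simp [h])
    have hc : cos u ≠ 0 := fun h => hsin (by simp [h])
    rw [← hu, hzu, Complex.cot, Complex.cot, Complex.sin_two_mul, Complex.cos_two_mul]
    field_simp
    ring

open Complex in
theorem hasSum_inv_sq_sub_sq {w : ℂ} (hw : ∀ n : ℤ, w ≠ n * π) :
    HasSum (fun n : ℕ => (-1 : ℂ) ^ n * (if n = 0 then 1 else 2) * (w ^ 2 - (n * π) ^ 2)⁻¹)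
      (1 / (w * sin w)) := by
  have hpi : (π : ℂ) ≠ 0 := by exact_mod_cast Real.pi_ne_zero
  have hw0 : w ≠ 0 := by simpa using hw 0
  have hz : w / π ∈ integerComplement := by
    rintro ⟨n, hn⟩
    exact hw n (by rw [hn]; field_simp)
  have hsin : sin w ≠ 0 := by
    intro h
    obtain ⟨n, hn⟩ := sin_eq_zero_iff.mp h
    exact hw n hn
  rw [← hasSum_nat_add_iff' 1]
  convert (hasSum_neg_one_pow_mul_cotTerm hz).mul_left (1 / (π * w)) using 1
  · rfl
  · ext n
    rw [cotTerm_identity hz, if_neg n.succ_ne_zero]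
    have h1 : w + (n + 1) * π ≠ 0 := by
      have := hw (-(n + 1))
      push_cast at this
      contrapose! this
      linear_combination this
    have h2 : w - (n + 1) * π ≠ 0 := by
      have := hw (n + 1)
      push_cast at this
      contrapose! this
      linear_combination this
    rw [show w / π + (n + 1) = (w + (n + 1) * π) / π by field_simp,
      show w / π - (n + 1) = (w - (n + 1) * π) / π by field_simp]
    push_cast
    rw [show w ^ 2 - ((n + 1) * π : ℂ) ^ 2 = (w + (n + 1) * π) * (w - (n + 1) * π) by ring]
    field_simp
  · simp only [Finset.sum_range_one, mul_div_cancel₀ w hpi]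
    simp
    field_simp

theorem summable_abs_neg_one_pow_mul_aCoef_mul_cCoef (k ε : ℝ) (m : ℕ) :
    Summable (fun n : ℕ => |(-1 : ℝ) ^ n * aCoef m n * cCoef k ε m n|) := by
  refine Summable.of_norm_bounded_eventually_nat
    (g := fun n : ℕ => 4 * (1 / (n : ℝ) ^ 2))
    ((Real.summable_one_div_nat_pow.mpr one_lt_two).mul_left 4) ?_
  set s : ℝ := k ^ 2 - (m * π / ε) ^ 2
  filter_upwards [eventually_ge_atTop (max 1 ⌈|s|⌉₊)] with n hn
  have h1 : (1 : ℝ) ≤ n := by exact_mod_cast (le_max_left _ _).trans hn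
  have hs : |s| ≤ n := (Nat.le_ceil _).trans (by exact_mod_cast (le_max_right _ _).trans hn)
  have ha : |aCoef m n| ≤ 4 := by
    unfold aCoef
    split_ifs <;> norm_num
  have hpi : (n * 3 : ℝ) ^ 2 ≤ (n * π) ^ 2 := by
    gcongr
    exact Real.pi_gt_three.le
  have hd : (n : ℝ) ^ 2 ≤ |s - (n * π) ^ 2| := by
    rw [abs_sub_comm]
    refine le_trans ?_ (le_abs_self _)
    nlinarith [le_abs_self s]
  rw [Real.norm_eq_abs, abs_abs, abs_mul, abs_mul, abs_pow, abs_neg, abs_one, one_pow, one_mul]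
  unfold cCoef
  rw [abs_inv, one_div]
  gcongr

theorem aCoef_eq_mul (m n : ℕ) :
    aCoef m n = (if m = 0 then 1 else 2) * (if n = 0 then 1 else 2) := by
  unfold aCoef
  split_ifs <;> first | simp_all; done | norm_num

/-- The inner series, in terms of a complex square root `w` of `k² - (mπ/ε)²`. -/
theorem hasSum_neg_one_pow_mul_aCoef_mul_cCoef {k ε : ℝ} {m : ℕ} {w : ℂ} {r : ℝ}
    (hw : ∀ n : ℤ, w ≠ n * π) (hsq : w ^ 2 = ((k ^ 2 - (m * π / ε) ^ 2 : ℝ) : ℂ))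
    (hr : 1 / (w * Complex.sin w) = (r : ℂ)) :
    HasSum (fun n : ℕ => (-1 : ℝ) ^ n * aCoef m n * cCoef k ε m n)
      ((if m = 0 then 1 else 2) * r) := by
  have h := hasSum_inv_sq_sub_sq hw
  rw [hr, hsq] at h
  have hreal : HasSum (fun n : ℕ => (-1 : ℝ) ^ n * (if n = 0 then 1 else 2) *
      cCoef k ε m n) r := by
    rw [← Complex.hasSum_ofReal]
    convert h using 2 with n
    unfold cCoef
    split_ifs <;> push_cast <;> rfl
  refine (hreal.mul_left (if m = 0 then 1 else 2)).congr_fun fun n => ?_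
  rw [aCoef_eq_mul]
  ring

theorem tsum_neg_one_pow_mul_aCoef_mul_cCoef_zero {k : ℝ} (hkπ : ∀ m : ℤ, k ≠ m * π) (ε : ℝ) :
    ∑' n : ℕ, (-1 : ℝ) ^ n * aCoef 0 n * cCoef k ε 0 n = 1 / (k * Real.sin k) := by
  simpa using (hasSum_neg_one_pow_mul_aCoef_mul_cCoef (k := k) (ε := ε) (m := 0) (w := k)
    (r := 1 / (k * Real.sin k)) (fun n => by exact_mod_cast hkπ n) (by simp)
    (by push_cast; rfl)).tsum_eq

theorem tsum_neg_one_pow_mul_aCoef_mul_cCoef_of_ne_zero {k ε κ : ℝ} {m : ℕ} (hm : m ≠ 0)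
    (hκ : 0 < κ) (hsq : κ ^ 2 = (m * π / ε) ^ 2 - k ^ 2) :
    ∑' n : ℕ, (-1 : ℝ) ^ n * aCoef m n * cCoef k ε m n = -(2 / (κ * Real.sinh κ)) := by
  have h := (hasSum_neg_one_pow_mul_aCoef_mul_cCoef (k := k) (ε := ε) (m := m)
    (w := κ * Complex.I) (r := -(1 / (κ * Real.sinh κ))) ?_ ?_ ?_).tsum_eq
  · rw [h, if_neg hm]
    ring
  · intro n hn
    have := congrArg Complex.im hn
    simp [hκ.ne'] at this
  · rw [mul_pow, Complex.I_sq, ← Complex.ofReal_pow, hsq]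
    push_cast
    ring
  · rw [Complex.sin_mul_I]
    push_cast
    rw [show (κ * Complex.I * (Complex.sinh κ * Complex.I) : ℂ) =
      -(κ * Complex.sinh κ) by linear_combination (κ * Complex.sinh κ : ℂ) * Complex.I_sq]
    rw [one_div_neg_eq_neg_one_div]

theorem abs_tsum_neg_one_pow_mul_aCoef_mul_cCoef_succ_le {k ε : ℝ} (hk : 0 < k) (hε : 0 < ε)
    (hε1 : ε ≤ 1) (hεk : ε ≤ 2 / k) (m : ℕ) :
    |∑' n : ℕ, (-1 : ℝ) ^ n * aCoef (m + 1) n * cCoef k ε (m + 1) n| ≤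
      4 * Real.exp (-2 / ε) * Real.exp (-2) ^ m := by
  set M : ℝ := ((m + 1 : ℕ) : ℝ) / ε with hM
  have hεinv : 1 ≤ 1 / ε := by rwa [le_div_iff₀ hε, one_mul]
  have hMlb : 1 / ε + m ≤ M := by
    have hm : (m : ℝ) * 1 ≤ m * (1 / ε) := by gcongr
    rw [hM]
    push_cast
    rw [add_div]
    linarith [mul_one_div (m : ℝ) ε]
  have hkM : k ≤ 2 * M := by
    have h : k ≤ 2 * (1 / ε) := by
      rw [le_div_iff₀ hk] at hεk
      rw [mul_one_div, le_div_iff₀ hε]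
      linarith
    linarith [(Nat.cast_nonneg m : (0 : ℝ) ≤ m)]
  have hM1 : 1 ≤ M := by linarith [(Nat.cast_nonneg m : (0 : ℝ) ≤ m)]
  have hge : (2 * M) ^ 2 ≤ (((m + 1 : ℕ) : ℝ) * π / ε) ^ 2 - k ^ 2 := by
    rw [show ((m + 1 : ℕ) : ℝ) * π / ε = M * π by rw [hM]; ring]
    have h3 : (M * 3) ^ 2 ≤ (M * π) ^ 2 := by
      gcongr
      exact Real.pi_gt_three.le
    nlinarith
  obtain ⟨κ, hκ⟩ : ∃ κ : ℝ, κ = √((((m + 1 : ℕ) : ℝ) * π / ε) ^ 2 - k ^ 2) := ⟨_, rfl⟩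
  have hκM : 2 * M ≤ κ := by
    rw [hκ]
    exact Real.le_sqrt_of_sq_le hge
  have hκ0 : 0 < κ := by linarith
  have hsq : κ ^ 2 = (((m + 1 : ℕ) : ℝ) * π / ε) ^ 2 - k ^ 2 := by
    rw [hκ, Real.sq_sqrt ((sq_nonneg _).trans hge)]
  rw [tsum_neg_one_pow_mul_aCoef_mul_cCoef_of_ne_zero m.succ_ne_zero hκ0 hsq, abs_neg]
  have hexp : 2 ≤ Real.exp κ := by linarith [Real.add_one_le_exp κ]
  have hsinh : Real.exp κ / 4 ≤ Real.sinh κ := by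
    have h1 : Real.exp (-κ) ≤ 1 := Real.exp_le_one_iff.mpr (by linarith)
    rw [Real.sinh_eq]
    linarith
  have hsinh0 : 0 < Real.sinh κ := by linarith
  rw [abs_of_pos (by positivity)]
  calc 2 / (κ * Real.sinh κ) ≤ 2 / (2 * (Real.exp κ / 4)) := by
        gcongr
        linarith
    _ = 4 * Real.exp (-κ) := by
        rw [Real.exp_neg]
        field_simp
    _ ≤ 4 * Real.exp (-2 / ε + m * (-2)) := by
        gcongr
        linarith [show -2 / ε = -2 * (1 / ε) by ring]
    _ = 4 * Real.exp (-2 / ε) * Real.exp (-2) ^ m := by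
        rw [Real.exp_add, Real.exp_nat_mul]
        ring

/-- Fix `k > 0` with `k/π` not an integer. For every `ε ∈ (0, π/k)`
and `m ≥ 0` the series `t_m(ε) = Σ_n (−1)ⁿ a_{mn} c_{mn}(ε)` converges absolutely.
There exist `ε₀, C > 0` such that for `ε ∈ (0,ε₀)` and `X, Y ∈ [-1/2,1/2]`, the series
`G̃_ε(X,Y) = ε⁻¹ Σ_m t_m(ε) cos(mπ(X+1/2)) cos(mπ(Y+1/2))` converges absolutely and
`|G̃_ε(X,Y) − 1/(εk sin k)| ≤ C e^{−1/ε}`. -/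
theorem stmt_14 (k : ℝ) (hk : 0 < k) (hkπ : ∀ m : ℤ, k ≠ m * π) :
    (∀ ε : ℝ, 0 < ε → ε < π / k → ∀ m : ℕ,
      Summable (fun n : ℕ => |(-1 : ℝ) ^ n * aCoef m n * cCoef k ε m n|)) ∧
    ∃ ε₀ > 0, ∃ C > 0, ∀ ε : ℝ, 0 < ε → ε < ε₀ →
      ∀ X Y : ℝ, X ∈ Set.Icc (-(1 : ℝ) / 2) (1 / 2) → Y ∈ Set.Icc (-(1 : ℝ) / 2) (1 / 2) →
        Summable (fun m : ℕ =>
          |(∑' n : ℕ, (-1 : ℝ) ^ n * aCoef m n * cCoef k ε m n) *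
            Real.cos (m * π * (X + 1 / 2)) * Real.cos (m * π * (Y + 1 / 2))|) ∧
        |ε⁻¹ * (∑' m : ℕ,
              (∑' n : ℕ, (-1 : ℝ) ^ n * aCoef m n * cCoef k ε m n) *
                Real.cos (m * π * (X + 1 / 2)) * Real.cos (m * π * (Y + 1 / 2))) -
            1 / (ε * k * Real.sin k)|
          ≤ C * Real.exp (-1 / ε) := by
  have hgeom := summable_geometric_of_lt_one (Real.exp_pos (-2)).le
    (Real.exp_lt_one_iff.mpr (by norm_num))
  refine ⟨fun ε _ _ m => summable_abs_neg_one_pow_mul_aCoef_mul_cCoef k ε m,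
    min 1 (2 / k), by positivity, 4 * ∑' m : ℕ, Real.exp (-2) ^ m, ?_, ?_⟩
  · exact mul_pos four_pos (hgeom.tsum_pos (fun m => by positivity) 0 (by positivity))
  intro ε hε hε₀ X Y _ _
  set F : ℕ → ℝ := fun m => (∑' n : ℕ, (-1 : ℝ) ^ n * aCoef m n * cCoef k ε m n) *
    Real.cos (m * π * (X + 1 / 2)) * Real.cos (m * π * (Y + 1 / 2)) with hF
  have hbound (m : ℕ) : ‖F (m + 1)‖ ≤ 4 * Real.exp (-2 / ε) * Real.exp (-2) ^ m := by
    simp only [hF, Real.norm_eq_abs]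
    rw [abs_mul, abs_mul]
    refine le_trans ?_ (abs_tsum_neg_one_pow_mul_aCoef_mul_cCoef_succ_le hk hε
      (hε₀.le.trans (min_le_left _ _)) (hε₀.le.trans (min_le_right _ _)) m)
    exact (mul_le_of_le_one_right (by positivity) (Real.abs_cos_le_one _)).trans
      (mul_le_of_le_one_right (abs_nonneg _) (Real.abs_cos_le_one _))
  have hmaj := hgeom.mul_left (4 * Real.exp (-2 / ε))
  have hsum : Summable F :=
    (summable_nat_add_iff 1).mp (Summable.of_norm_bounded hmaj hbound)
  refine ⟨hsum.abs, ?_⟩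
  have hF0 : F 0 = 1 / (k * Real.sin k) := by
    simp only [hF, Nat.cast_zero, zero_mul, Real.cos_zero, mul_one]
    exact tsum_neg_one_pow_mul_aCoef_mul_cCoef_zero hkπ ε
  have hdiff : ε⁻¹ * (∑' m, F m) - 1 / (ε * k * Real.sin k) = ε⁻¹ * ∑' m, F (m + 1) := by
    rw [hsum.tsum_eq_zero_add, hF0, mul_add, mul_assoc ε, ← one_div_mul_one_div ε, one_div ε]
    ring
  have hexp : ε⁻¹ * Real.exp (-2 / ε) ≤ Real.exp (-1 / ε) := by
    rw [show -2 / ε = -ε⁻¹ + -1 / ε by ring, Real.exp_add, ← mul_assoc]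
    refine mul_le_of_le_one_left (Real.exp_pos _).le ?_
    rw [Real.exp_neg, ← div_eq_mul_inv, div_le_one (Real.exp_pos _)]
    linarith [Real.add_one_le_exp ε⁻¹]
  rw [hdiff, abs_mul, abs_of_pos (inv_pos.mpr hε)]
  calc ε⁻¹ * |∑' m, F (m + 1)|
      ≤ ε⁻¹ * ∑' m : ℕ, 4 * Real.exp (-2 / ε) * Real.exp (-2) ^ m := by
        gcongr
        exact tsum_of_norm_bounded hmaj.hasSum hbound
    _ = (4 * ∑' m : ℕ, Real.exp (-2) ^ m) * (ε⁻¹ * Real.exp (-2 / ε)) := by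
        rw [tsum_mul_left]
        ring
    _ ≤ (4 * ∑' m : ℕ, Real.exp (-2) ^ m) * Real.exp (-1 / ε) := by
        gcongr
end
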